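/- Let (H, ◁◁, K) be a right Hopf module of cocommutative Hopf algebras. For linear maps A, B : H → K define (A # B)(f) := A(f₍₁₎ ◁◁ S_K((B(f₍₂₎))₍₁₎)) · (B(f₍₂₎))₍₂₎. Then # is an associative product on Hom(H, K) with unit η_K ∘ ε_H. -/

import Mathlib

open TensorProduct

/-- The `#`-product of linear maps `A, B : H → K`:
`(A # B)(f) = A(f₍₁₎ ◁◁ S_K((B f₍₂₎)₍₁₎)) · (B f₍₂₎)₍₂₎`. -/
noncomputable def hashMul {R H K : Type*} [CommRing R] [Ring H] [Ring K]
    [HopfAlgebra R H] [HopfAlgebra R K]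
    (act : H →ₗ[R] K →ₗ[R] H) (A B : H →ₗ[R] K) : H →ₗ[R] K :=
  (LinearMap.mul' R K)
    ∘ₗ (TensorProduct.map A LinearMap.id)
    ∘ₗ (TensorProduct.map (TensorProduct.lift act) LinearMap.id)
    ∘ₗ (TensorProduct.map
          (TensorProduct.map LinearMap.id (HopfAlgebra.antipode (R := R))) LinearMap.id)
    ∘ₗ (TensorProduct.assoc R H K K).symm.toLinearMap
    ∘ₗ (TensorProduct.map LinearMap.id (Coalgebra.comul ∘ₗ B))
    ∘ₗ Coalgebra.comul

/-- The convolution unit `η_K ∘ ε_H : H → K`. -/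
noncomputable def hashUnit (R : Type*) (H K : Type*) [CommRing R] [Ring H] [Ring K]
    [HopfAlgebra R H] [HopfAlgebra R K] : H →ₗ[R] K :=
  (Algebra.linearMap R K) ∘ₗ Coalgebra.counit

section Cocommutative

open Coalgebra HopfAlgebra

variable {R K : Type*} [CommRing R] [Ring K] [HopfAlgebra R K]

/-- The antipode of a cocommutative Hopf algebra is comultiplicative. -/
theorem comul_antipode_of_isCocomm [IsCocomm R K] (k : K) :
    comul (R := R) (antipode R k) = TensorProduct.map (antipode R) (antipode R) (comul k) := by
  have hleft : WithConv.toConv (TensorProduct.map (antipode R) (antipode R) ∘ₗ comul (A := K)) *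
      WithConv.toConv comul = 1 := by
    have h := LinearMap.convMul_comp_coalgHom_distrib
      (WithConv.toConv (TensorProduct.map (antipode R (A := K)) (antipode R (A := K))))
      (WithConv.toConv (TensorProduct.map LinearMap.id LinearMap.id)) (comulCoalgHom R K)
    have h₂ := TensorProduct.map_convMul_map (f := WithConv.toConv (antipode R (A := K)))
      (h := WithConv.toConv LinearMap.id) (g := WithConv.toConv (antipode R (A := K)))
      (k := WithConv.toConv LinearMap.id)
    rw [LinearMap.antipode_mul_id] at h₂
    rw [h₂] at h
    apply WithConv.ofConv_injective
    refine Eq.trans ?_ (h.symm.trans ?_)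
    · rw [TensorProduct.map_id]
      rfl
    · ext x
      change TensorProduct.map (Algebra.linearMap R K ∘ₗ counit) (Algebra.linearMap R K ∘ₗ counit)
        (comul x) = algebraMap R (K ⊗[R] K) (counit x)
      rw [TensorProduct.map_comp, LinearMap.comp_apply,
        ← LinearMap.lTensor_comp_rTensor (f := counit) (g := counit), LinearMap.comp_apply,
        rTensor_counit_comul]
      simp [Algebra.algebraMap_eq_smul_one, Algebra.TensorProduct.one_def]
  exact congr($((left_inv_eq_right_inv hleft LinearMap.comul_right_inv).symm).ofConv k)

end Cocommutative

section Hash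

open Coalgebra HopfAlgebra

variable {R H K : Type*} [CommRing R] [Ring H] [Ring K] [HopfAlgebra R H] [HopfAlgebra R K]

/-- The bilinear map `(h, k) ↦ A(h ◁◁ S(k₍₁₎)) · k₍₂₎` underlying the `#`-product. -/
noncomputable def hashTwist (act : H →ₗ[R] K →ₗ[R] H) (A : H →ₗ[R] K) : H →ₗ[R] K →ₗ[R] K :=
  TensorProduct.curry <|
    (LinearMap.mul' R K)
      ∘ₗ (TensorProduct.map A LinearMap.id)
      ∘ₗ (TensorProduct.map (TensorProduct.lift act) LinearMap.id)
      ∘ₗ (TensorProduct.map (TensorProduct.map LinearMap.id (antipode R)) LinearMap.id)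
      ∘ₗ (TensorProduct.assoc R H K K).symm.toLinearMap
      ∘ₗ (TensorProduct.map LinearMap.id comul)

variable {act : H →ₗ[R] K →ₗ[R] H}

theorem hashTwist_eq_sum (A : H →ₗ[R] K) (h : H) {k : K} {ι : Type*} (r : Repr R k ι) :
    hashTwist act A h k
      = ∑ i ∈ r.index, A (act h (antipode R (r.left i))) * r.right i := by
  simp [hashTwist, ← r.eq, TensorProduct.tmul_sum]

theorem hashMul_eq_sum (A B : H →ₗ[R] K) {f : H} {ι : Type*} (r : Repr R f ι) :
    hashMul act A B f = ∑ i ∈ r.index, hashTwist act A (r.left i) (B (r.right i)) := by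
  simp [hashMul, hashTwist, ← r.eq]

theorem hashTwist_one (hact_one : ∀ h : H, act h 1 = h) (A : H →ₗ[R] K) (h : H) :
    hashTwist act A h 1 = A h := by
  simp [hashTwist, Algebra.TensorProduct.one_def, hact_one]

theorem hashTwist_mul (hact_comp : ∀ (h : H) (k k' : K), act (act h k) k' = act h (k * k'))
    (A : H →ₗ[R] K) (h : H) (b : K) {c : K} {ι : Type*} (r : Repr R c ι) :
    hashTwist act A h (b * c)
      = ∑ i ∈ r.index, hashTwist act A (act h (antipode R (r.left i))) b * r.right i := by
  rw [hashTwist_eq_sum A h ((ℛ R b).mul r)]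
  simp only [hashTwist_eq_sum A _ (ℛ R b), hact_comp, ← antipode_mul_antidistrib]
  simp [Finset.sum_product_right, Finset.sum_mul, mul_assoc]

theorem hashMul_act_antipode [IsCocomm R K]
    (hact_comul : ∀ (h : H) (k : K),
      comul (act h k)
        = (TensorProduct.map (TensorProduct.lift act) (TensorProduct.lift act))
            ((TensorProduct.tensorTensorTensorComm R H H K K) (comul h ⊗ₜ[R] comul k)))
    (A B : H →ₗ[R] K) {h : H} {k : K} {ι κ : Type*} (r : Repr R h ι) (s : Repr R k κ) :
    hashMul act A B (act h (antipode R k))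
      = ∑ i ∈ r.index, ∑ j ∈ s.index,
          hashTwist act A (act (r.left i) (antipode R (s.left j)))
            (B (act (r.right i) (antipode R (s.right j)))) := by
  rw [hashMul_eq_sum A B (f := act h (antipode R k)) (ι := ι × κ)
    { index := r.index ×ˢ s.index
      left := fun p ↦ act (r.left p.1) (antipode R (s.left p.2))
      right := fun p ↦ act (r.right p.1) (antipode R (s.right p.2))
      eq := by
        simp [hact_comul, comul_antipode_of_isCocomm, ← r.eq, ← s.eq, TensorProduct.sum_tmul,
          TensorProduct.tmul_sum, Finset.sum_product_right] }]
  exact Finset.sum_product ..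

theorem hashTwist_hashMul [IsCocomm R K]
    (hact_comp : ∀ (h : H) (k k' : K), act (act h k) k' = act h (k * k'))
    (hact_comul : ∀ (h : H) (k : K),
      comul (act h k)
        = (TensorProduct.map (TensorProduct.lift act) (TensorProduct.lift act))
            ((TensorProduct.tensorTensorTensorComm R H H K K) (comul h ⊗ₜ[R] comul k)))
    (A B : H →ₗ[R] K) {h : H} {ι : Type*} (r : Repr R h ι) (c : K) :
    hashTwist act (hashMul act A B) h c
      = ∑ i ∈ r.index, hashTwist act A (r.left i) (hashTwist act B (r.right i) c) := by
  have key (x y : H) :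
      ∑ j ∈ (ℛ R c).index, ∑ q ∈ (ℛ R ((ℛ R c).left j)).index,
        hashTwist act A (act x (antipode R ((ℛ R ((ℛ R c).left j)).left q)))
          (B (act y (antipode R ((ℛ R ((ℛ R c).left j)).right q)))) * (ℛ R c).right j
      = hashTwist act A x (hashTwist act B y c) := by
    let T : K ⊗[R] (K ⊗[R] K) →ₗ[R] K :=
      LinearMap.mul' R K ∘ₗ TensorProduct.map
        (TensorProduct.lift (hashTwist act A) ∘ₗ
          TensorProduct.map (act x ∘ₗ antipode R) (B ∘ₗ act y ∘ₗ antipode R) ∘ₗ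
          (TensorProduct.comm R K K).toLinearMap) LinearMap.id ∘ₗ
        (TensorProduct.assoc R K K K).symm.toLinearMap
    have hT := congr(T $(coassoc_apply (R := R) c))
    rw [hashTwist_eq_sum B y (ℛ R c), map_sum]
    simp only [hashTwist_mul hact_comp A x _ (ℛ R _)]
    trans T (TensorProduct.assoc R K K K (comul.rTensor K (comul c)))
    · simp only [T, LinearMap.comp_apply, LinearEquiv.coe_coe, LinearEquiv.symm_apply_apply]
      rw [← (ℛ R c).eq]
      simp only [map_sum, LinearMap.rTensor_tmul, TensorProduct.map_tmul, LinearMap.comp_apply,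
        LinearEquiv.coe_coe, comm_comul]
      refine Finset.sum_congr rfl fun j _ ↦ ?_
      rw [← (ℛ R ((ℛ R c).left j)).eq]
      simp [Finset.sum_mul]
    · rw [hT]
      nth_rw 1 [← (ℛ R c).eq]
      simp only [map_sum, LinearMap.lTensor_tmul]
      refine Finset.sum_congr rfl fun j _ ↦ ?_
      rw [← (ℛ R ((ℛ R c).right j)).eq]
      simp [T, TensorProduct.tmul_sum]
  rw [hashTwist_eq_sum _ h (ℛ R c)]
  simp only [hashMul_act_antipode hact_comul A B r (ℛ R _), Finset.sum_mul]
  rw [Finset.sum_comm]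
  exact Finset.sum_congr rfl fun i _ ↦ key _ _

theorem hashMul_assoc [IsCocomm R K]
    (hact_comp : ∀ (h : H) (k k' : K), act (act h k) k' = act h (k * k'))
    (hact_comul : ∀ (h : H) (k : K),
      comul (act h k)
        = (TensorProduct.map (TensorProduct.lift act) (TensorProduct.lift act))
            ((TensorProduct.tensorTensorTensorComm R H H K K) (comul h ⊗ₜ[R] comul k)))
    (A B C : H →ₗ[R] K) :
    hashMul act (hashMul act A B) C = hashMul act A (hashMul act B C) := by
  ext f
  let r := ℛ R f
  have h := congr((TensorProduct.lift (hashTwist act A) ∘ₗ TensorProduct.map LinearMap.id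
    (TensorProduct.lift (hashTwist act B) ∘ₗ TensorProduct.map LinearMap.id C))
    $(sum_tmul_tmul_eq r (fun i ↦ ℛ R (r.left i)) (fun i ↦ ℛ R (r.right i))))
  simp only [map_sum, LinearMap.comp_apply, TensorProduct.map_tmul, TensorProduct.lift.tmul,
    LinearMap.id_apply] at h
  simp only [hashMul_eq_sum _ _ r, hashTwist_hashMul hact_comp hact_comul A B (ℛ R _),
    hashMul_eq_sum B C (ℛ R _), map_sum]
  exact h

/-- An action compatible with products, coproducts and antipodes preserves counits. -/
theorem counit_act
    (hone_act : ∀ k : K, act 1 k = counit (R := R) k • (1 : H))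
    (hact_mul : ∀ (h₁ h₂ : H) (k : K),
      act (h₁ * h₂) k
        = (LinearMap.mul' R H) ((TensorProduct.map (act h₁) (act h₂)) (comul k)))
    (hact_comul : ∀ (h : H) (k : K),
      comul (act h k)
        = (TensorProduct.map (TensorProduct.lift act) (TensorProduct.lift act))
            ((TensorProduct.tensorTensorTensorComm R H H K K) (comul h ⊗ₜ[R] comul k)))
    (hact_antipode : ∀ (h : H) (k : K),
      antipode R (act h k) = act (antipode R h) k)
    (h : H) (k : K) :
    counit (R := R) (act h k) = counit (R := R) h * counit (R := R) k := by
  have key : algebraMap R H (counit (act h k)) = act (algebraMap R H (counit h)) k := by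
    rw [← mul_antipode_rTensor_comul_apply, ← sum_antipode_mul_eq_algebraMap_counit (ℛ R h),
      hact_comul]
    simp only [map_sum, LinearMap.sum_apply, hact_mul]
    nth_rw 1 [← (ℛ R h).eq]
    simp [← (ℛ R k).eq, TensorProduct.sum_tmul, TensorProduct.tmul_sum, hact_antipode]
    exact Finset.sum_comm
  have := congr(counit (R := R) $key)
  simpa [Algebra.algebraMap_eq_smul_one, hone_act] using this

theorem hashMul_hashUnit (hact_one : ∀ h : H, act h 1 = h) (A : H →ₗ[R] K) :
    hashMul act A (hashUnit R H K) = A := by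
  ext f
  rw [hashMul_eq_sum _ _ (ℛ R f)]
  have h := congr(A (TensorProduct.rid R H $(sum_tmul_counit_eq (R := R) (ℛ R f))))
  simp only [map_sum, TensorProduct.rid_tmul, one_smul, map_smul] at h
  simpa [hashUnit, Algebra.algebraMap_eq_smul_one, hashTwist_one hact_one] using h

theorem hashUnit_hashMul
    (hcounit : ∀ (h : H) (k : K),
      counit (R := R) (act h k) = counit (R := R) h * counit (R := R) k)
    (A : H →ₗ[R] K) : hashMul act (hashUnit R H K) A = A := by
  have htwist (h : H) (k : K) : hashTwist act (hashUnit R H K) h k = counit (R := R) h • k := by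
    rw [hashTwist_eq_sum _ _ (ℛ R k)]
    simp only [hashUnit, LinearMap.comp_apply, hcounit, counit_antipode,
      Algebra.linearMap_apply, ← Algebra.smul_def, mul_smul, ← Finset.smul_sum, sum_counit_smul]
  ext f
  rw [hashMul_eq_sum _ _ (ℛ R f)]
  simp only [htwist, ← map_smul, ← map_sum, sum_counit_smul]

end Hash

/-- For a right Hopf module `(H, ◁◁, K)` of cocommutative Hopf algebras,
the `#`-product is associative on `Hom(H, K)` with unit `η_K ∘ ε_H`. -/
theorem hash_associative_with_unit
    {R H K : Type*} [CommRing R] [Ring H] [Ring K]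
    [HopfAlgebra R H] [HopfAlgebra R K]
    (hcoH : ∀ x : H, (TensorProduct.comm R H H) (Coalgebra.comul x) = Coalgebra.comul x)
    (hcoK : ∀ x : K, (TensorProduct.comm R K K) (Coalgebra.comul x) = Coalgebra.comul x)
    (act : H →ₗ[R] K →ₗ[R] H)
    (hact_one : ∀ h : H, act h 1 = h)
    (hone_act : ∀ k : K, act 1 k = Coalgebra.counit (R := R) k • (1 : H))
    (hact_mul : ∀ (h₁ h₂ : H) (k : K),
      act (h₁ * h₂) k
        = (LinearMap.mul' R H) ((TensorProduct.map (act h₁) (act h₂)) (Coalgebra.comul k)))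
    (hact_comp : ∀ (h : H) (k k' : K), act (act h k) k' = act h (k * k'))
    (hact_comul : ∀ (h : H) (k : K),
      Coalgebra.comul (act h k)
        = (TensorProduct.map (TensorProduct.lift act) (TensorProduct.lift act))
            ((TensorProduct.tensorTensorTensorComm R H H K K)
              (Coalgebra.comul h ⊗ₜ[R] Coalgebra.comul k)))
    (hact_antipode : ∀ (h : H) (k : K),
      HopfAlgebra.antipode (R := R) (act h k) = act (HopfAlgebra.antipode (R := R) h) k) :
    (∀ A B C : H →ₗ[R] K,
      hashMul act (hashMul act A B) C = hashMul act A (hashMul act B C)) ∧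
    (∀ A : H →ₗ[R] K, hashMul act A (hashUnit R H K) = A) ∧
    (∀ A : H →ₗ[R] K, hashMul act (hashUnit R H K) A = A) := by
  have : Coalgebra.IsCocomm R K := ⟨LinearMap.ext hcoK⟩
  exact ⟨hashMul_assoc hact_comp hact_comul, hashMul_hashUnit hact_one,
    hashUnit_hashMul (counit_act hone_act hact_mul hact_comul hact_antipode)⟩
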